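/- Let R be a ring and M a left R-module that is semiartinian, self-injective, a self-cogenerator, and is the internal direct sum M = ⊕_{β ∈ I} M_β of a family of indecomposable submodules M_β. Then the following are equivalent: (a) M is a distributive left R-module; (b) each M_β is uniserial and the family {M_β}_{β ∈ I} is unrelated; (c) End_R(M) is isomorphic as a ring to a direct product of right chain rings; (d) End_R(M) is a right distributive ring. -/

import Mathlib

/-!
STATEMENT 7. Endomorphisms of a left module are written on the right in the paper, so the
paper's endomorphism ring `S` is the opposite of Lean's `Module.End R M`.  Under this
convention the paper's right ideals of `S` are Lean's `Ideal (Module.End R M)`, and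
"`S` is isomorphic to a direct product of right chain rings" becomes "`Module.End R M` is
isomorphic to a direct product of rings whose `Ideal`s are totally ordered by inclusion".
-/

universe u

/-- A left `R`-module `M` is semiartinian if every nonzero factor module of `M` contains a
simple submodule (equivalently, an atom of its submodule lattice). -/
def IsSemiartinianMod (R M : Type u) [Ring R] [AddCommGroup M] [Module R M] : Prop :=
  ∀ N : Submodule R M, N ≠ ⊤ → ∃ T : Submodule R (M ⧸ N), IsAtom T

/-- A left `R`-module `M` is self-injective if every `R`-linear map from a submodule of `M`
into `M` extends to an endomorphism of `M`. -/
def IsSelfInjective (R M : Type u) [Ring R] [AddCommGroup M] [Module R M] : Prop :=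
  ∀ (N : Submodule R M) (f : N →ₗ[R] M), ∃ g : Module.End R M, ∀ x : N, g x = f x

/-- A left `R`-module `M` is a self-cogenerator if every factor module of `M` embeds into a
direct product of copies of `M`. -/
def IsSelfCogenerator (R M : Type u) [Ring R] [AddCommGroup M] [Module R M] : Prop :=
  ∀ N : Submodule R M, ∃ (ι : Type u) (φ : (M ⧸ N) →ₗ[R] (ι → M)), Function.Injective φ

/-- If `M` is self-injective, then a linear map `f : K → M` factors through `i : K → M` as soon as
`f` vanishes on the kernel of `i`. -/
theorem IsSelfInjective.exists_comp_eq {R M : Type u} [Ring R] [AddCommGroup M] [Module R M]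
    (h : IsSelfInjective R M) {K : Type*} [AddCommGroup K] [Module R K]
    (i f : K →ₗ[R] M) (hk : ∀ x, i x = 0 → f x = 0) :
    ∃ g : Module.End R M, ∀ x, g (i x) = f x := by
  have hle : LinearMap.ker i ≤ LinearMap.ker f := fun x hx => hk x hx
  obtain ⟨g, hg⟩ := h (LinearMap.range i)
    ((LinearMap.ker i).liftQ f hle ∘ₗ i.quotKerEquivRange.symm.toLinearMap)
  refine ⟨g, fun x => ?_⟩
  have hx : i.quotKerEquivRange.symm ⟨i x, x, rfl⟩ = (LinearMap.ker i).mkQ x := by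
    rw [LinearEquiv.symm_apply_eq]
    rfl
  simpa [hx] using hg ⟨i x, x, rfl⟩

/-- A retract of a self-injective module is self-injective. -/
theorem IsSelfInjective.of_retract {R M : Type u} [Ring R] [AddCommGroup M] [Module R M]
    (h : IsSelfInjective R M) {X : Submodule R M} (p : M →ₗ[R] X)
    (hp : ∀ x : X, p x = x) : IsSelfInjective R X := by
  intro N f
  obtain ⟨g, hg⟩ := h.exists_comp_eq (X.subtype ∘ₗ N.subtype) (X.subtype ∘ₗ f)
    (fun x hx => by
      have : x = 0 := by simpa using hx
      simp [this])
  refine ⟨p ∘ₗ g ∘ₗ X.subtype, fun x => ?_⟩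
  have := hg x
  simp only [LinearMap.comp_apply, Submodule.subtype_apply] at this ⊢
  rw [this, hp]

/-- Every submodule of a self-cogenerator is an intersection of kernels of endomorphisms. -/
theorem IsSelfCogenerator.exists_end {R M : Type u} [Ring R] [AddCommGroup M] [Module R M]
    (h : IsSelfCogenerator R M) (N : Submodule R M) {x : M} (hx : x ∉ N) :
    ∃ f : Module.End R M, (∀ y ∈ N, f y = 0) ∧ f x ≠ 0 := by
  obtain ⟨κ, φ, hφ⟩ := h N
  have hne : φ (N.mkQ x) ≠ 0 := fun h0 =>
    hx ((Submodule.Quotient.mk_eq_zero N).1 (hφ (h0.trans (map_zero φ).symm)))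
  obtain ⟨k, hk⟩ := Function.ne_iff.1 hne
  refine ⟨LinearMap.proj k ∘ₗ φ ∘ₗ N.mkQ, fun y hy => ?_, hk⟩
  simp [(Submodule.Quotient.mk_eq_zero N).2 hy]

/-- Given disjoint submodules `A` and `B`, there is a submodule containing `A` which is maximal
among the submodules disjoint from `B`. -/
theorem Submodule.exists_le_maximal_disjoint {R M : Type*} [Ring R] [AddCommGroup M] [Module R M]
    {A B : Submodule R M} (h : Disjoint A B) :
    ∃ C, A ≤ C ∧ Maximal (fun D => Disjoint D B) C := by
  refine zorn_le_nonempty₀ {D | Disjoint D B} (fun c hc hchain y hy => ?_) A h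
  refine ⟨sSup c, ?_, fun z hz => le_sSup hz⟩
  exact (hchain.directedOn.disjoint_sSup_left).2 fun b hb => hc hb

/-- Two submodules of a self-injective module which are complements of each other, in the sense
of maximality, are direct summands. -/
theorem IsSelfInjective.isCompl_of_maximal {R M : Type u} [Ring R] [AddCommGroup M] [Module R M]
    (h : IsSelfInjective R M) {C D : Submodule R M}
    (hC : Maximal (fun X => Disjoint X D) C) (hD : Maximal (fun X => Disjoint X C) D) :
    IsCompl C D := by
  have hdis : Disjoint C D := hC.prop
  obtain ⟨g, hg⟩ := h.exists_comp_eq (C.subtype.coprod D.subtype)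
    (C.subtype ∘ₗ LinearMap.fst R C D) (by
      rintro ⟨c, d⟩ hcd
      have hcd' : (c : M) + d = 0 := by simpa using hcd
      have hcD : (c : M) ∈ D := by
        rw [eq_neg_of_add_eq_zero_left hcd']
        exact D.neg_mem d.2
      exact Submodule.disjoint_def.1 hdis _ c.2 hcD)
  have hgC : ∀ c ∈ C, g c = c := fun c hc => by simpa using hg (⟨c, hc⟩, 0)
  have hgD : ∀ d ∈ D, g d = 0 := fun d hd => by simpa using hg (0, ⟨d, hd⟩)
  have hker : LinearMap.ker g ≤ D := by
    refine hD.le_of_ge (Submodule.disjoint_def.2 fun x hx hxC => ?_) hgD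
    rw [← hgC x hxC]
    exact hx
  have hran : LinearMap.range g ≤ C := by
    refine hC.le_of_ge (Submodule.disjoint_def.2 ?_) (fun c hc => ⟨c, hgC c hc⟩)
    rintro _ ⟨m, rfl⟩ hm
    have hsub : D ⊔ Submodule.span R {m} ≤ D := by
      refine hD.le_of_ge (Submodule.disjoint_def.2 fun x hx hxC => ?_) le_sup_left
      obtain ⟨d, hd, y, hy, rfl⟩ := Submodule.mem_sup.1 hx
      obtain ⟨r, rfl⟩ := Submodule.mem_span_singleton.1 hy
      have h1 := hgC _ hxC
      rw [map_add, hgD d hd, zero_add, map_smul] at h1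
      refine Submodule.disjoint_def.1 hdis _ hxC ?_
      rw [← h1]
      exact D.smul_mem r hm
    exact hgD m (hsub (Submodule.mem_sup_right (Submodule.mem_span_singleton_self m)))
  refine ⟨hdis, codisjoint_iff.2 (eq_top_iff.2 fun x _ => ?_)⟩
  have hx : g x ∈ C := hran ⟨x, rfl⟩
  refine Submodule.mem_sup.2 ⟨g x, hx, x - g x, hker ?_, by abel⟩
  rw [LinearMap.mem_ker, map_sub, hgC _ hx, sub_self]

/-- An indecomposable self-injective module is uniform. -/
theorem IsSelfInjective.uniform {R M : Type u} [Ring R] [AddCommGroup M] [Module R M]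
    (h : IsSelfInjective R M)
    (hidc : ∀ A B : Submodule R M, IsCompl A B → A = ⊥ ∨ B = ⊥)
    {A B : Submodule R M} (hAB : Disjoint A B) : A = ⊥ ∨ B = ⊥ := by
  obtain ⟨C, hAC, hC⟩ := Submodule.exists_le_maximal_disjoint hAB
  obtain ⟨D, hBD, hD⟩ := Submodule.exists_le_maximal_disjoint hC.prop.symm
  have hC' : Maximal (fun X => Disjoint X D) C :=
    ⟨hD.prop.symm, fun X hX hCX => hC.le_of_ge (hX.mono_right hBD) hCX⟩
  rcases hidc C D (h.isCompl_of_maximal hC' hD) with h0 | h0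
  · exact Or.inl (le_bot_iff.1 (h0 ▸ hAC))
  · exact Or.inr (le_bot_iff.1 (h0 ▸ hBD))

/-- A linear map out of an internal direct sum may be prescribed on the summands. -/
theorem iSupIndep.exists_linearMap_extension {R M P : Type*} [Ring R] [AddCommGroup M] [Module R M]
    [AddCommGroup P] [Module R P] {ι : Type*} {Mb : ι → Submodule R M}
    (hind : iSupIndep Mb) (hsup : iSup Mb = ⊤) (f : ∀ β, Mb β →ₗ[R] P) :
    ∃ g : M →ₗ[R] P, ∀ β (x : Mb β), g x = f β x := by
  classical
  have hint := DirectSum.isInternal_submodule_of_iSupIndep_of_iSup_eq_top hind hsup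
  let e := LinearEquiv.ofBijective (DirectSum.coeLinearMap Mb) hint
  refine ⟨DirectSum.toModule R ι P f ∘ₗ e.symm.toLinearMap, fun β x => ?_⟩
  have hx : e.symm (x : M) = DirectSum.lof R ι (fun β => Mb β) β x := by
    rw [LinearEquiv.symm_apply_eq]
    exact (DirectSum.coeLinearMap_lof Mb β x).symm
  simp [hx]

/-- Two linear maps agreeing on submodules which span the whole module are equal. -/
theorem LinearMap.ext_of_iSup_eq_top {R M P : Type*} [Ring R] [AddCommGroup M] [Module R M]
    [AddCommGroup P] [Module R P] {ι : Type*} {Mb : ι → Submodule R M}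
    (hsup : iSup Mb = ⊤) {f g : M →ₗ[R] P} (h : ∀ β, ∀ x ∈ Mb β, f x = g x) : f = g := by
  have hle : iSup Mb ≤ LinearMap.eqLocus f g := iSup_le h
  ext x
  exact hle (hsup ▸ Submodule.mem_top)

/-- The projections of an internal direct sum onto its summands. -/
theorem iSupIndep.exists_projections {R M : Type*} [Ring R] [AddCommGroup M] [Module R M]
    {ι : Type*} {Mb : ι → Submodule R M} (hind : iSupIndep Mb) (hsup : iSup Mb = ⊤) :
    ∃ p : ∀ β, M →ₗ[R] Mb β, (∀ β (x : Mb β), p β x = x) ∧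
      (∀ β γ, β ≠ γ → ∀ x : Mb β, p γ x = 0) ∧
      (∀ x (N : Submodule R M), (∀ β, (p β x : M) ∈ N) → x ∈ N) := by
  classical
  have hex : ∀ γ, ∃ q : M →ₗ[R] Mb γ, (∀ x : Mb γ, q x = x) ∧
      ∀ β, β ≠ γ → ∀ x : Mb β, q x = 0 := fun γ => by
    obtain ⟨q, hq⟩ := hind.exists_linearMap_extension hsup (P := Mb γ)
      (fun β => if h : β = γ then h ▸ LinearMap.id else 0)
    refine ⟨q, fun x => ?_, fun β hβ x => ?_⟩
    · simpa using hq γ x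
    · simpa [hβ] using hq β x
  choose p hp hp0 using hex
  refine ⟨p, hp, fun β γ => hp0 γ β, fun x N hx => ?_⟩
  have hx' : x ∈ iSup Mb := hsup ▸ Submodule.mem_top
  obtain ⟨s, hs⟩ : ∃ s : Finset ι, ∀ t, s ⊆ t → x = ∑ β ∈ t, (p β x : M) := by
    clear hx
    induction hx' using Submodule.iSup_induction' with
    | mem β y hy =>
      refine ⟨{β}, fun t ht => ?_⟩
      rw [Finset.sum_eq_single_of_mem β (ht (Finset.mem_singleton_self β))
        fun γ _ hγ => by simp [hp0 γ β hγ.symm ⟨y, hy⟩]]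
      simp [hp β ⟨y, hy⟩]
    | zero => exact ⟨∅, by simp⟩
    | add y z hy hz ihy ihz =>
      obtain ⟨s, hs⟩ := ihy 
      obtain ⟨s', hs'⟩ := ihz 
      refine ⟨s ∪ s', fun t ht => ?_⟩
      simp only [map_add, Submodule.coe_add, Finset.sum_add_distrib]
      rw [← hs t (Finset.union_subset_left ht), ← hs' t (Finset.union_subset_right ht)]
  rw [hs s subset_rfl]
  exact N.sum_mem fun β _ => hx β

/-- If all maps between factor modules of `M` and `P` vanish, then so do all maps from `M` to `P`. -/
theorem LinearMap.eq_zero_of_quotients {R M P : Type*} [Ring R] [AddCommGroup M] [Module R M]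
    [AddCommGroup P] [Module R P]
    (h : ∀ (N : Submodule R M) (L : Submodule R P) (f : (M ⧸ N) →ₗ[R] (P ⧸ L)), f = 0)
    (f : M →ₗ[R] P) : f = 0 := by
  ext x
  have := LinearMap.congr_fun
    (h ⊥ ⊥ ((⊥ : Submodule R M).liftQ ((⊥ : Submodule R P).mkQ ∘ₗ f) bot_le)) (Submodule.mkQ _ x)
  simpa using this

/-- A distributive module has no nonzero maps between subfactors of independent submodules. -/
theorem Submodule.eq_zero_of_distributive {R M : Type*} [Ring R] [AddCommGroup M] [Module R M]
    (hd : ∀ N L K : Submodule R M, N ⊓ (L ⊔ K) = (N ⊓ L) ⊔ (N ⊓ K))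
    {X Y : Submodule R M} (hXY : Disjoint X Y) (N : Submodule R X) (L : Submodule R Y)
    (f : (X ⧸ N) →ₗ[R] (Y ⧸ L)) : f = 0 := by
  let D : Submodule R M := (LinearMap.ker
    ((f ∘ₗ N.mkQ).coprod (-L.mkQ))).map (X.subtype.coprod Y.subtype)
  have hD : ∀ (x : X) (y : Y), (x : M) + y ∈ D → f (N.mkQ x) = L.mkQ y := by
    rintro x y ⟨⟨x', y'⟩, hxy, he⟩
    have he' : (x' : M) + y' = x + y := by simpa using he
    have hsub : (x' : M) - x = y - y' := by
      rw [sub_eq_sub_iff_add_eq_add, he', add_comm]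
    have h0 : (x' : M) - x = 0 := Submodule.disjoint_def.1 hXY _ (X.sub_mem x'.2 x.2)
      (hsub ▸ Y.sub_mem y.2 y'.2)
    have hx : x' = x := Subtype.ext (sub_eq_zero.1 h0)
    have hy : y = y' := Subtype.ext (sub_eq_zero.1 (hsub ▸ h0))
    subst hx hy
    have : f (N.mkQ x') + -L.mkQ y = 0 := by simpa using hxy
    rwa [← sub_eq_add_neg, sub_eq_zero] at this
  have key : ∀ x : X, f (N.mkQ x) = 0 := fun x => by
    obtain ⟨y, hy⟩ := L.mkQ_surjective (f (N.mkQ x))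
    have hmem : (x : M) + y ∈ D ⊓ (X ⊔ Y) := by
      refine ⟨⟨(x, y), ?_, by simp⟩, Submodule.add_mem_sup x.2 y.2⟩
      have : f (N.mkQ x) + -L.mkQ y = 0 := by rw [hy, add_neg_cancel]
      simpa using this
    rw [hd] at hmem
    obtain ⟨a, ha, b, hb, hab⟩ := Submodule.mem_sup.1 hmem
    have hsub : a - x = y - b := by
      rw [sub_eq_sub_iff_add_eq_add, hab, add_comm]
    have h0 : a - x = 0 := Submodule.disjoint_def.1 hXY _ (X.sub_mem ha.2 x.2)
      (hsub ▸ Y.sub_mem y.2 hb.2)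
    have hx := hD x 0 (by simpa [sub_eq_zero.1 h0] using ha.1)
    simpa using hx
  ext x
  exact key x

/-- In a distributive module, submodules `A` and `B` have no matching nonzero values under maps
that vanish on `A ⊓ B`. -/
theorem Submodule.eq_zero_of_distributive_of_inf {R M P : Type*} [Ring R] [AddCommGroup M]
    [Module R M] [AddCommGroup P] [Module R P]
    (hd : ∀ N L K : Submodule R M, N ⊓ (L ⊔ K) = (N ⊓ L) ⊔ (N ⊓ K))
    {A B : Submodule R M} {f g : M →ₗ[R] P} (hf : ∀ x ∈ A ⊓ B, f x = 0)
    (hg : ∀ x ∈ A ⊓ B, g x = 0) {a b : M} (ha : a ∈ A) (hb : b ∈ B) (hab : f a = g b) :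
    f a = 0 := by
  let D : Submodule R M := (LinearMap.ker ((f ∘ₗ A.subtype).coprod (-(g ∘ₗ B.subtype)))).map
    (A.subtype.coprod B.subtype)
  have hmem : a + b ∈ D ⊓ (A ⊔ B) := by
    refine ⟨⟨(⟨a, ha⟩, ⟨b, hb⟩), ?_, by simp⟩, Submodule.add_mem_sup ha hb⟩
    simp [hab]
  rw [hd] at hmem
  obtain ⟨a', ⟨⟨⟨c, d⟩, hcd, he⟩, ha'⟩, b', hb', hs⟩ := Submodule.mem_sup.1 hmem
  have he' : (c : M) + d = a' := by simpa using he
  have hcd' : f c + -g d = 0 := by simpa using hcd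
  have hdA : (d : M) ∈ A := by
    rw [eq_sub_of_add_eq' he']
    exact A.sub_mem ha' c.2
  have hfa' : f a' = 0 := by
    rw [hg d ⟨hdA, d.2⟩, neg_zero, add_zero] at hcd'
    rw [← he', map_add, hcd', hf d ⟨hdA, d.2⟩, add_zero]
  have hsub : a - a' = b' - b := by
    rw [sub_eq_sub_iff_add_eq_add, ← hs, add_comm]
  have h0 := hf (a - a') ⟨A.sub_mem ha ha', hsub ▸ B.sub_mem hb'.2 hb⟩
  rwa [map_sub, hfa', sub_zero] at h0

/-- If the members of a decomposition of a self-injective self-cogenerator admit no nonzero maps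
between each other, then every submodule is homogeneous. -/
theorem Submodule.projection_mem_of_hom_eq_zero {R M : Type u} [Ring R]
    [AddCommGroup M] [Module R M] (hsi : IsSelfInjective R M) (hsc : IsSelfCogenerator R M)
    {ι : Type*} {Mb : ι → Submodule R M} (hsup : iSup Mb = ⊤)
    {p : ∀ β, M →ₗ[R] Mb β} (hp : ∀ β (x : Mb β), p β x = x)
    (hp0 : ∀ β γ, β ≠ γ → ∀ x : Mb β, p γ x = 0)
    (hpN : ∀ x (N : Submodule R M), (∀ β, (p β x : M) ∈ N) → x ∈ N)
    (hhom : ∀ β γ, β ≠ γ → ∀ f : Mb β →ₗ[R] Mb γ, f = 0)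
    (N : Submodule R M) {n : M} (hn : n ∈ N) (β : ι) : (p β n : M) ∈ N := by
  let P : Module.End R M := (Mb β).subtype ∘ₗ p β
  let Q : Module.End R M := LinearMap.id - P
  by_contra hcon
  have hnU : n ∉ (N ⊓ Mb β) ⊔ (N ⊓ LinearMap.ker P) := fun hU => by
    obtain ⟨a, ha, b, hb, rfl⟩ := Submodule.mem_sup.1 hU
    have hb0 : (p β b : M) = 0 := hb.2
    rw [map_add, Submodule.coe_add, hb0, add_zero, hp β ⟨a, ha.2⟩] at hcon
    exact hcon ha.1
  obtain ⟨φ, hφ, hφn⟩ := hsc.exists_end _ hnU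
  obtain ⟨g, hg⟩ := hsi.exists_comp_eq (P ∘ₗ N.subtype) (φ ∘ₗ N.subtype)
    fun x hx => hφ x (Submodule.mem_sup_right ⟨x.2, hx⟩)
  obtain ⟨g', hg'⟩ := hsi.exists_comp_eq (Q ∘ₗ N.subtype) (φ ∘ₗ N.subtype) fun x hx => by
    have hx' : (x : M) = p β x := sub_eq_zero.1 hx
    exact hφ x (Submodule.mem_sup_left ⟨x.2, hx' ▸ (p β x).2⟩)
  have hgn : g (p β n) = φ n := hg ⟨n, hn⟩
  have hgn' : g' (Q n) = φ n := hg' ⟨n, hn⟩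
  refine hφn ((Submodule.mem_bot R).1 (hpN _ _ fun δ => ?_))
  rw [Submodule.mem_bot, ZeroMemClass.coe_eq_zero]
  by_cases hδ : β = δ
  · subst hδ
    have h0 : p β ∘ₗ g' ∘ₗ Q = 0 := LinearMap.ext_of_iSup_eq_top hsup fun γ x hx => by
      by_cases hγ : γ = β
      · subst hγ
        simp [Q, P, hp γ ⟨x, hx⟩]
      · have := LinearMap.congr_fun (hhom γ β hγ (p β ∘ₗ g' ∘ₗ (Mb γ).subtype)) ⟨x, hx⟩
        simpa [Q, P, hp0 γ β hγ ⟨x, hx⟩] using this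
    rw [← hgn']
    exact LinearMap.congr_fun h0 n
  · rw [← hgn]
    exact LinearMap.congr_fun (hhom β δ hδ (p δ ∘ₗ g ∘ₗ (Mb β).subtype)) (p β n)

/-- The left ideals of the endomorphism ring of a uniserial self-injective module form a chain. -/
theorem IsSelfInjective.ideal_le_total {R M : Type u} [Ring R] [AddCommGroup M] [Module R M]
    (h : IsSelfInjective R M) (hu : ∀ A B : Submodule R M, A ≤ B ∨ B ≤ A)
    (I J : Ideal (Module.End R M)) : I ≤ J ∨ J ≤ I := by
  by_contra! hcon
  obtain ⟨f, hfI, hfJ⟩ := SetLike.not_le_iff_exists.1 hcon.1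
  obtain ⟨g, hgJ, hgI⟩ := SetLike.not_le_iff_exists.1 hcon.2
  rcases hu (LinearMap.ker f) (LinearMap.ker g) with hk | hk
  · obtain ⟨k, hkk⟩ := h.exists_comp_eq f g hk
    have : k * f = g := LinearMap.ext hkk
    exact hgI (this ▸ I.mul_mem_left k hfI)
  · obtain ⟨k, hkk⟩ := h.exists_comp_eq g f hk
    have : k * g = f := LinearMap.ext hkk
    exact hfJ (this ▸ J.mul_mem_left k hgJ)

/-- The lattice of left ideals of a product of left chain rings is distributive. -/
theorem Pi.ideal_inf_sup_le {κ : Type*} {S : κ → Type*} [∀ i, Ring (S i)]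
    (hS : ∀ i, ∀ I J : Ideal (S i), I ≤ J ∨ J ≤ I) (I J K : Ideal (∀ i, S i)) :
    I ⊓ (J ⊔ K) ≤ (I ⊓ J) ⊔ (I ⊓ K) := by
  classical
  rintro x ⟨hxI, hx⟩
  obtain ⟨j, hj, k, hk, rfl⟩ := Submodule.mem_sup.1 hx
  have hcmp : ∀ i, (∃ s, s * k i = j i) ∨ ∃ s, s * j i = k i := fun i => by
    rcases hS i (Ideal.span {j i}) (Ideal.span {k i}) with h | h
    · exact Or.inl (Ideal.mem_span_singleton'.1 (h (Ideal.mem_span_singleton_self _)))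
    · exact Or.inr (Ideal.mem_span_singleton'.1 (h (Ideal.mem_span_singleton_self _)))
  have hex : ∃ e s t : ∀ i, S i, e * j = s * k ∧ (1 - e) * k = t * j := by
    have h : ∀ i, ∃ e s t : S i, e * j i = s * k i ∧ (1 - e) * k i = t * j i := fun i => by
      rcases hcmp i with ⟨s, hs⟩ | ⟨s, hs⟩
      · exact ⟨1, s, 0, by simp [hs], by simp⟩
      · exact ⟨0, 0, s, by simp, by simp [hs]⟩
    choose e s t h1 h2 using h
    exact ⟨e, s, t, funext h1, funext h2⟩
  obtain ⟨e, s, t, h1, h2⟩ := hex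
  refine Submodule.mem_sup.2 ⟨(1 - e) * (j + k), ⟨I.mul_mem_left _ hxI, ?_⟩, e * (j + k),
    ⟨I.mul_mem_left _ hxI, ?_⟩, by noncomm_ring⟩
  · rw [mul_add, h2]
    exact J.add_mem (J.mul_mem_left _ hj) (J.mul_mem_left _ hj)
  · rw [mul_add, h1]
    exact K.add_mem (K.mul_mem_left _ hk) (K.mul_mem_left _ hk)

/-- Distributivity of the lattice of left ideals is invariant under ring isomorphism. -/
theorem RingEquiv.ideal_inf_sup_eq {A B : Type*} [Ring A] [Ring B] (e : A ≃+* B)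
    (h : ∀ I J K : Ideal B, I ⊓ (J ⊔ K) ≤ (I ⊓ J) ⊔ (I ⊓ K)) (I J K : Ideal A) :
    I ⊓ (J ⊔ K) = (I ⊓ J) ⊔ (I ⊓ K) := by
  refine le_antisymm ?_ le_inf_sup
  let φ : Ideal B ≃o Ideal A := e.idealComapOrderIso
  obtain ⟨I, rfl⟩ := φ.surjective I
  obtain ⟨J, rfl⟩ := φ.surjective J
  obtain ⟨K, rfl⟩ := φ.surjective K
  simpa only [← map_sup, ← map_inf, φ.le_iff_le] using h I J K

/-- A decomposition whose members admit no nonzero maps between each other decomposes the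
endomorphism ring as a product. -/
theorem Module.End.nonempty_ringEquiv_pi {R M : Type*} [Ring R] [AddCommGroup M] [Module R M]
    {ι : Type*} {Mb : ι → Submodule R M} (hind : iSupIndep Mb) (hsup : iSup Mb = ⊤)
    {p : ∀ β, M →ₗ[R] Mb β}
    (hpN : ∀ x (N : Submodule R M), (∀ β, (p β x : M) ∈ N) → x ∈ N)
    (hhom : ∀ β γ, β ≠ γ → ∀ f : Mb β →ₗ[R] Mb γ, f = 0) :
    Nonempty (Module.End R M ≃+* ∀ β, Module.End R (Mb β)) := by
  have hmap : ∀ (f : Module.End R M) β, ∀ x ∈ Mb β, f x ∈ Mb β := fun f β x hx => by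
    refine hpN _ _ fun γ => ?_
    by_cases hγ : β = γ
    · subst hγ
      exact (p β (f x)).2
    · have h0 : p γ (f x) = 0 :=
        LinearMap.congr_fun (hhom β γ hγ (p γ ∘ₗ f ∘ₗ (Mb β).subtype)) ⟨x, hx⟩
      simp [h0]
  let F : Module.End R M →+* ∀ β, Module.End R (Mb β) :=
    { toFun := fun f β => f.restrict (hmap f β)
      map_one' := rfl
      map_mul' := fun _ _ => rfl
      map_zero' := rfl
      map_add' := fun _ _ => rfl }
  have hF : ∀ f β (x : Mb β), (F f β x : M) = f x := fun _ _ _ => rfl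
  refine ⟨RingEquiv.ofBijective F ⟨fun f g hfg => ?_, fun f => ?_⟩⟩
  · refine LinearMap.ext_of_iSup_eq_top hsup fun β x hx => ?_
    rw [← hF f β ⟨x, hx⟩, ← hF g β ⟨x, hx⟩, hfg]
  · obtain ⟨g, hg⟩ := hind.exists_linearMap_extension hsup fun β => (Mb β).subtype ∘ₗ f β
    exact ⟨g, funext fun β => LinearMap.ext fun x => Subtype.ext (hg β x)⟩

/-- The left ideal of endomorphisms vanishing on a submodule. -/
def Submodule.endAnnihilator {R M : Type*} [Ring R] [AddCommGroup M] [Module R M]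
    (N : Submodule R M) : Ideal (Module.End R M) where
  carrier := {f | ∀ x ∈ N, f x = 0}
  add_mem' := fun hf hg x hx => by simp [hf x hx, hg x hx]
  zero_mem' := fun _ _ => rfl
  smul_mem' := fun c f hf x hx => by simp [hf x hx]

theorem Submodule.mem_endAnnihilator {R M : Type*} [Ring R] [AddCommGroup M] [Module R M]
    {N : Submodule R M} {f : Module.End R M} :
    f ∈ N.endAnnihilator ↔ ∀ x ∈ N, f x = 0 := Iff.rfl

theorem Submodule.endAnnihilator_sup {R M : Type*} [Ring R] [AddCommGroup M] [Module R M]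
    (N L : Submodule R M) :
    (N ⊔ L).endAnnihilator = N.endAnnihilator ⊓ L.endAnnihilator := by
  ext f
  exact sup_le_iff (a := N) (b := L) (c := LinearMap.ker f)

theorem IsSelfInjective.endAnnihilator_inf {R M : Type u} [Ring R] [AddCommGroup M] [Module R M]
    (h : IsSelfInjective R M) (N L : Submodule R M) :
    (N ⊓ L).endAnnihilator = N.endAnnihilator ⊔ L.endAnnihilator := by
  refine le_antisymm (fun f hf => ?_)
    (sup_le (fun f hf x hx => hf x hx.1) fun f hf x hx => hf x hx.2)
  obtain ⟨g, hg⟩ := h.exists_comp_eq (N.subtype.coprod L.subtype)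
    (f ∘ₗ L.subtype ∘ₗ LinearMap.snd R N L) (by
      rintro ⟨n, l⟩ hnl
      have hnl' : (n : M) + l = 0 := by simpa using hnl
      have hl : (l : M) ∈ N := by
        rw [eq_neg_of_add_eq_zero_right hnl']
        exact N.neg_mem n.2
      exact hf l ⟨hl, l.2⟩)
  refine Submodule.mem_sup.2 ⟨g, fun x hx => ?_, f - g, fun x hx => ?_, by abel⟩
  · simpa using hg (⟨x, hx⟩, 0)
  · have : g x = f x := by simpa using hg (0, ⟨x, hx⟩)
    simp [this]

theorem IsSelfCogenerator.le_of_endAnnihilator_le {R M : Type u} [Ring R] [AddCommGroup M]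
    [Module R M] (h : IsSelfCogenerator R M) {N L : Submodule R M}
    (hNL : L.endAnnihilator ≤ N.endAnnihilator) : N ≤ L := by
  intro x hx
  by_contra hxL
  obtain ⟨f, hf, hfx⟩ := h.exists_end L hxL
  exact hfx (hNL hf x hx)

/-- In a distributive self-cogenerator, uniform direct summands which admit no nonzero maps to the
other summands are uniserial. -/
theorem IsSelfCogenerator.le_total_of_distributive {R M : Type u} [Ring R] [AddCommGroup M]
    [Module R M] (hsc : IsSelfCogenerator R M)
    (hd : ∀ N L K : Submodule R M, N ⊓ (L ⊔ K) = (N ⊓ L) ⊔ (N ⊓ K))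
    {ι : Type*} {Mb : ι → Submodule R M} {p : ∀ β, M →ₗ[R] Mb β}
    (hpN : ∀ x (N : Submodule R M), (∀ β, (p β x : M) ∈ N) → x ∈ N)
    (hhom : ∀ β γ, β ≠ γ → ∀ f : Mb β →ₗ[R] Mb γ, f = 0) {β : ι}
    (huni : ∀ A B : Submodule R (Mb β), Disjoint A B → A = ⊥ ∨ B = ⊥)
    (A B : Submodule R (Mb β)) : A ≤ B ∨ B ≤ A := by
  by_contra! hcon
  have hinj := (Mb β).subtype_injective
  have hex : ∀ C D : Submodule R (Mb β), ¬ C ≤ D → ∃ f : M →ₗ[R] Mb β,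
      (∀ x ∈ D, f x = 0) ∧ C.map (f ∘ₗ (Mb β).subtype) ≠ ⊥ := fun C D hCD => by
    obtain ⟨c, hc, hcD⟩ := SetLike.not_le_iff_exists.1 hCD
    obtain ⟨φ, hφ, hφc⟩ := hsc.exists_end (D.map (Mb β).subtype) (x := c) (by simpa using hcD)
    refine ⟨p β ∘ₗ φ, fun x hx => ?_, fun hbot => hφc ?_⟩
    · simp [hφ x (Submodule.mem_map_of_mem (f := (Mb β).subtype) hx)]
    · refine (Submodule.mem_bot R).1 (hpN _ _ fun γ => ?_)
      rw [Submodule.mem_bot, ZeroMemClass.coe_eq_zero]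
      by_cases hγ : β = γ
      · subst hγ
        exact (Submodule.mem_bot R).1 (hbot ▸ Submodule.mem_map_of_mem hc)
      · exact LinearMap.congr_fun (hhom β γ hγ (p γ ∘ₗ φ ∘ₗ (Mb β).subtype)) c
  obtain ⟨f, hf, hfA⟩ := hex A B hcon.1
  obtain ⟨g, hg, hgB⟩ := hex B A hcon.2
  have hdis : Disjoint (A.map (f ∘ₗ (Mb β).subtype)) (B.map (g ∘ₗ (Mb β).subtype)) := by
    rw [Submodule.disjoint_def]
    rintro _ ⟨a, ha, rfl⟩ ⟨b, hb, hab⟩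
    refine Submodule.eq_zero_of_distributive_of_inf hd (A := A.map (Mb β).subtype)
      (B := B.map (Mb β).subtype) (f := f) (g := g) ?_ ?_ (Submodule.mem_map_of_mem ha)
      (Submodule.mem_map_of_mem hb) hab.symm
    · rintro _ ⟨-, y, hy, rfl⟩
      exact hf y hy
    · rintro _ ⟨⟨y, hy, rfl⟩, -⟩
      exact hg y hy
  exact (huni _ _ hdis).elim hfA hgB

/-- Let `M` be a semiartinian self-injective self-cogenerator left `R`-module which is the
internal direct sum of a family of indecomposable submodules `Mb β`.  Then the following
are equivalent: (a) `M` is distributive; (b) the `Mb β` are uniserial and form an unrelated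
family; (c) `End_R(M)` is isomorphic to a direct product of (right, in the paper's
convention) chain rings; (d) `End_R(M)` is (right) distributive. -/
theorem distributive_tfae_for_selfinjective_cogenerator (R M : Type u) [Ring R]
    [AddCommGroup M] [Module R M]
    (hsa : IsSemiartinianMod R M) (hsi : IsSelfInjective R M) (hsc : IsSelfCogenerator R M)
    {ι : Type u} (Mb : ι → Submodule R M)
    (hind : iSupIndep Mb) (hsup : iSup Mb = ⊤)
    (hidc : ∀ β, Mb β ≠ ⊥ ∧
      ∀ A B : Submodule R (Mb β), IsCompl A B → A = ⊥ ∨ B = ⊥) :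
    List.TFAE
      [ -- (a) `M` is distributive
        ∀ N L K : Submodule R M, N ⊓ (L ⊔ K) = (N ⊓ L) ⊔ (N ⊓ K),
        -- (b) unrelated family of uniserial modules
        (∀ β, ∀ A B : Submodule R (Mb β), A ≤ B ∨ B ≤ A) ∧
          (∀ β γ, β ≠ γ → ∀ (N : Submodule R (Mb β)) (L : Submodule R (Mb γ))
            (f : ((Mb β) ⧸ N) →ₗ[R] ((Mb γ) ⧸ L)), f = 0),
        -- (c) the endomorphism ring is a direct product of chain rings
        ∃ (κ : Type u) (S : κ → RingCat.{u}),
          (∀ i, ∀ I J : Ideal ↥(S i), I ≤ J ∨ J ≤ I) ∧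
            Nonempty (Module.End R M ≃+* ((i : κ) → ↥(S i))),
        -- (d) the endomorphism ring is distributive
        ∀ I J K : Ideal (Module.End R M), I ⊓ (J ⊔ K) = (I ⊓ J) ⊔ (I ⊓ K) ] := by
  obtain ⟨p, hp, hp0, hpN⟩ := hind.exists_projections hsup
  tfae_have 1 → 2 := fun hd => by
    have hunrel : ∀ β γ, β ≠ γ → ∀ (N : Submodule R (Mb β)) (L : Submodule R (Mb γ))
        (f : ((Mb β) ⧸ N) →ₗ[R] ((Mb γ) ⧸ L)), f = 0 := fun β γ hβγ =>
      Submodule.eq_zero_of_distributive hd (hind.pairwiseDisjoint hβγ)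
    refine ⟨fun β => hsc.le_total_of_distributive hd hpN
      (fun β γ hβγ => LinearMap.eq_zero_of_quotients (hunrel β γ hβγ)) fun A B hAB => ?_, hunrel⟩
    exact (hsi.of_retract (p β) (hp β)).uniform (hidc β).2 hAB
  tfae_have 2 → 3 := fun ⟨hu, hunrel⟩ => by
    refine ⟨ι, fun β => RingCat.of (Module.End R (Mb β)), fun β =>
      (hsi.of_retract (p β) (hp β)).ideal_le_total (hu β), ?_⟩
    exact Module.End.nonempty_ringEquiv_pi hind hsup hpN
      fun β γ hβγ => LinearMap.eq_zero_of_quotients (hunrel β γ hβγ)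
  tfae_have 3 → 4 := fun ⟨κ, S, hS, ⟨e⟩⟩ => e.ideal_inf_sup_eq (Pi.ideal_inf_sup_le hS)
  tfae_have 4 → 1 := fun hd N L K => by
    refine le_antisymm (hsc.le_of_endAnnihilator_le ?_) le_inf_sup
    rw [Submodule.endAnnihilator_sup, hsi.endAnnihilator_inf, hsi.endAnnihilator_inf,
      hsi.endAnnihilator_inf, Submodule.endAnnihilator_sup]
    exact (DistribLattice.ofInfSupLe fun I J K => (hd I J K).le).le_sup_inf _ _ _
  tfae_finish
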